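/- Let k ≥ 1, let D be a labeled ordered instance with labels in {0,1}, let R be a nonempty family of nonempty subsets of D (the possible worlds for 1-NN classification), and let T be a set of k−1 additional tuples, each strictly smaller in the extended order than every tuple of D, whose labels, listed in increasing order of the tuples of T, are 0, 1, 0, 1, … (so exactly ⌈(k−1)/2⌉ tuples of T have label 0 and ⌊(k−1)/2⌋ have label 1). Assume that some world I ∈ R has a 0-labeled <-minimal element. Then the test point is certifiably robust for 1-NN classification with respect to the worlds R if and only if it is certifiably robust for k-NN classification with respect to the worlds {I ∪ T : I ∈ R}. -/

import Mathlib

variable {T : Type*}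

/-- The k-neighborhood: the set of the `k` smallest elements of `I` under `<`. -/
def nbhd [LinearOrder T] (k : ℕ) (I : Finset T) : Finset T :=
  I.filter fun t => (I.filter fun s => s < t).card < k

/-- `labCount L k ℓ I = C(ℓ, I)`: the number of elements of the `k`-neighborhood
of `I` carrying label `ℓ`. -/
def labCount [LinearOrder T] (L : T → Bool) (k : ℕ) (ℓ : Bool) (I : Finset T) : ℕ :=
  ((nbhd k I).filter fun t => L t = ℓ).card

/-- Certifiable robustness for `k`-NN classification with respect to a set of
possible worlds `W`: one single label is assigned (i.e. is a strict plurality in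
the `k`-neighborhood) in every world of `W`. -/
def Robust [LinearOrder T] (L : T → Bool) (k : ℕ) (W : Set (Finset T)) : Prop :=
  ∃ ℓ : Bool, ∀ I ∈ W, ∀ ℓ' : Bool, ℓ' ≠ ℓ → labCount L k ℓ' I < labCount L k ℓ I

open Finset

/-- In a finite set labeled `0, 1, 0, 1, …` in increasing order, the label `ℓ` occurs
`⌈n / 2⌉` times if `ℓ = 0` and `⌊n / 2⌋` times if `ℓ = 1`. -/
theorem card_filter_of_alternating [LinearOrder T] (L : T → Bool) (S : Finset T) :
    (∀ s ∈ S, L s = decide ((S.filter fun u => u < s).card % 2 = 1)) →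
    (S.filter fun t => L t = false).card = (S.card + 1) / 2 ∧
      (S.filter fun t => L t = true).card = S.card / 2 := by
  induction S using Finset.induction_on_max with
  | empty => simp
  | insert a S ha ih =>
    intro h
    have haS : a ∉ S := fun hm => lt_irrefl a (ha a hm)
    have hbelow : (insert a S).filter (fun u => u < a) = S := by
      ext u
      simp only [mem_filter, mem_insert]
      constructor
      · rintro ⟨rfl | hu, hlt⟩
        · exact absurd hlt (lt_irrefl _)
        · exact hu
      · exact fun hu => ⟨Or.inr hu, ha u hu⟩
    have hS : ∀ s ∈ S, L s = decide ((S.filter fun u => u < s).card % 2 = 1) := by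
      intro s hs
      have := h s (mem_insert_of_mem hs)
      rwa [filter_insert, if_neg (ha s hs).not_gt] at this
    obtain ⟨h₀, h₁⟩ := ih hS
    have hLa := h a (mem_insert_self a S)
    rw [hbelow] at hLa
    rw [filter_insert, filter_insert, card_insert_of_notMem haS]
    have hn : ∀ ℓ, a ∉ S.filter fun t => L t = ℓ := fun ℓ hm => haS (mem_filter.1 hm).1
    by_cases hp : S.card % 2 = 1
    · have hL : L a = true := by simp [hLa, hp]
      simp only [hL, Bool.true_eq_false, if_false, if_true, card_insert_of_notMem (hn true)]
      omega
    · have hL : L a = false := by simp [hLa, hp]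
      simp only [hL, Bool.false_eq_true, if_false, if_true, card_insert_of_notMem (hn false)]
      omega

/-- If the elements of `S` lie below those of `I`, then the `|S| + 1` smallest elements of
`I ∪ S` are those of `S` together with the least element of `I`. -/
theorem nbhd_union_of_lt [LinearOrder T] {I S : Finset T} {m : T} (hS : ∀ s ∈ S, ∀ t ∈ I, s < t)
    (hm : m ∈ I) (hmin : ∀ t ∈ I, m ≤ t) : nbhd (S.card + 1) (I ∪ S) = insert m S := by
  have hmS : m ∉ S := fun h => lt_irrefl m (hS m h m hm)
  ext t
  simp only [nbhd, mem_filter, mem_union, mem_insert]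
  constructor
  · rintro ⟨ht | ht, hc⟩
    · by_contra! hne
      have hsub : insert m S ⊆ (I ∪ S).filter fun s => s < t := by
        intro s hs
        rw [mem_filter, mem_union]
        rcases mem_insert.1 hs with rfl | hs
        · exact ⟨Or.inl hm, lt_of_le_of_ne (hmin t ht) hne.1.symm⟩
        · exact ⟨Or.inr hs, hS s hs t ht⟩
      have := card_le_card hsub
      rw [card_insert_of_notMem hmS] at this
      omega
    · exact Or.inr ht
  · intro ht
    have hle : t ≤ m := by
      rcases ht with rfl | ht
      · exact le_rfl
      · exact (hS t ht m hm).le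
    refine ⟨ht.imp (fun h : t = m => h ▸ hm) id, Nat.lt_succ_of_le (card_le_card fun s hs => ?_)⟩
    obtain ⟨hs, hst⟩ := mem_filter.1 hs
    rcases mem_union.1 hs with hs | hs
    · exact absurd (hst.trans_le hle) (hmin s hs).not_gt
    · exact hs

/-- When an alternatingly labeled set `S` is put below all worlds, and some world has a
`0`-labeled least element, robustness for `(|S| + 1)`-NN means that the least element of every
world is labeled `0`. -/
theorem robust_union_iff [LinearOrder T] {D S : Finset T} {L : T → Bool} {R : Set (Finset T)}
    (hR : ∀ I ∈ R, I ⊆ D ∧ I.Nonempty) (hSD : ∀ s ∈ S, ∀ t ∈ D, s < t)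
    (hSlab : ∀ s ∈ S, L s = decide ((S.filter fun u => u < s).card % 2 = 1))
    (h0 : ∃ I ∈ R, ∃ t ∈ I, (∀ s ∈ I, t ≤ s) ∧ L t = false) :
    Robust L (S.card + 1) ((fun I => I ∪ S) '' R) ↔
      ∀ I ∈ R, ∀ m ∈ I, (∀ s ∈ I, m ≤ s) → L m = false := by
  obtain ⟨hc₀, hc₁⟩ := card_filter_of_alternating L S hSlab
  have hcount : ∀ I ∈ R, ∀ m ∈ I, (∀ s ∈ I, m ≤ s) → ∀ ℓ,
      labCount L (S.card + 1) ℓ (I ∪ S) =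
        (S.filter fun t => L t = ℓ).card + if L m = ℓ then 1 else 0 := by
    intro I hI m hm hmin ℓ
    have hmS : m ∉ S := fun h => lt_irrefl m (hSD m h m ((hR I hI).1 hm))
    rw [labCount, nbhd_union_of_lt (fun s hs t ht => hSD s hs t ((hR I hI).1 ht)) hm hmin,
      filter_insert]
    split_ifs
    · exact card_insert_of_notMem fun h => hmS (mem_filter.1 h).1
    · rfl
  constructor
  · rintro ⟨ℓ, hℓ⟩ I hI m hm hmin
    obtain ⟨J, hJ, t, ht, htmin, hLt⟩ := h0
    have hJℓ := hℓ _ ⟨J, hJ, rfl⟩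
    have hIℓ := hℓ _ ⟨I, hI, rfl⟩
    simp only [hcount J hJ t ht htmin, hcount I hI m hm hmin, hLt] at hJℓ hIℓ
    by_contra hLm
    rw [Bool.not_eq_false] at hLm
    cases ℓ
    · have := hIℓ true (by simp)
      simp only [hc₀, hc₁, hLm, if_true, Bool.true_eq_false, if_false] at this
      omega
    · have := hJℓ false (by simp)
      simp only [hc₀, hc₁, if_true, Bool.false_eq_true, if_false] at this
      omega
  · rintro h
    refine ⟨false, ?_⟩
    rintro _ ⟨I, hI, rfl⟩ ℓ hℓ
    obtain rfl : ℓ = true := by simpa using hℓ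
    have hne := (hR I hI).2
    have hm := I.min'_mem hne
    have hmin : ∀ s ∈ I, I.min' hne ≤ s := fun s hs => I.min'_le s hs
    simp only [hcount I hI _ hm hmin, h I hI _ hm hmin, hc₀, hc₁, if_true,
      Bool.false_eq_true, if_false]
    omega

theorem stmt6 [LinearOrder T]
    (k : ℕ) (hk : 1 ≤ k)
    (D Tset : Finset T) (L : T → Bool)
    (R : Set (Finset T)) (hRne : R.Nonempty)
    (hR : ∀ I ∈ R, I ⊆ D ∧ I.Nonempty)
    -- Tset consists of k-1 additional tuples, each smaller than every tuple of D
    (hTcard : Tset.card = k - 1)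
    (hTD : ∀ s ∈ Tset, ∀ t ∈ D, s < t)
    -- the labels of Tset, in increasing order, are 0, 1, 0, 1, …
    (hTlab : ∀ s ∈ Tset, L s = decide ((Tset.filter fun u => u < s).card % 2 = 1))
    -- some world of R has a 0-labeled <-minimal element
    (h0 : ∃ I ∈ R, ∃ t ∈ I, (∀ s ∈ I, t ≤ s) ∧ L t = false) :
    Robust L 1 R ↔ Robust L k ((fun I => I ∪ Tset) '' R) := by
  have hk' : Tset.card + 1 = k := by omega
  have hone := robust_union_iff (S := ∅) hR (by simp) (by simp) h0
  simp only [card_empty, zero_add, union_empty, Set.image_id'] at hone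
  rw [hone, ← hk', robust_union_iff hR hTD hTlab h0]
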